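/- arXiv:2410.22812 — 3 statements merged into one kernel-verified Lean document; each statement's English description precedes it below -/
import Mathlib

section
/- Under the discard workflow, the limiting Gaussian process has linearly exploding variance: let v_T > 0 and v_Θ ≥ 1/v_T be real numbers, and on a probability space define real-valued random variables recursively by W_Θ(1) ~ N(0, v_Θ), and for each G ≥ 2: W_T(G) = Z_G + v_T·W_Θ(G−1) where Z_G ~ N(0, v_T) is independent of (Z_2,…,Z_{G−1}, ε_2,…,ε_{G−1}, W_Θ(1)), and W_Θ(G) = v_T^{−1}·W_T(G) + ε_G where ε_G ~ N(0, v_Θ − v_T^{−1}) is independent of (Z_2,…,Z_G, ε_2,…,ε_{G−1}, W_Θ(1)). Then for every G ≥ 1, Var(W_Θ(G)) = G·v_Θ; consequently the asymptotic relative efficiency ARE(G) := Var(W_Θ(1))/Var(W_Θ(G)) equals 1/G and tends to 0 as G → ∞. -/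
open MeasureTheory ProbabilityTheory Filter
open scoped ENNReal NNReal Topology

lemma memLp_two_of_map_eq_gaussianReal {Ω : Type*} [MeasurableSpace Ω] {P : Measure Ω}
    {X : Ω → ℝ} (hX : Measurable X) {m : ℝ} {v : ℝ≥0} (h : P.map X = gaussianReal m v) :
    MemLp X 2 P := by
  have h2 : MemLp id 2 (P.map X) := h ▸ memLp_id_gaussianReal' 2 (by simp)
  exact (memLp_map_measure_iff aestronglyMeasurable_id hX.aemeasurable).1 h2

lemma variance_of_map_eq_gaussianReal {Ω : Type*} [MeasurableSpace Ω] {P : Measure Ω}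
    {X : Ω → ℝ} (hX : Measurable X) {m : ℝ} {v : ℝ≥0} (h : P.map X = gaussianReal m v) :
    variance X P = v := by
  rw [← variance_id_map hX.aemeasurable, h, variance_id_gaussianReal]

/-- The σ-algebra generated by `X` and by `Z g`, `ε g` for `2 ≤ g ≤ n`. -/
abbrev noisePast {Ω : Type*} (X : Ω → ℝ) (Z ε : ℕ → Ω → ℝ) (n : ℕ) : MeasurableSpace Ω :=
  (MeasurableSpace.comap X inferInstance) ⊔
    ⨆ g ∈ Finset.Icc 2 n,
      (MeasurableSpace.comap (Z g) inferInstance ⊔ MeasurableSpace.comap (ε g) inferInstance)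

lemma noisePast_mono {Ω : Type*} (X : Ω → ℝ) (Z ε : ℕ → Ω → ℝ) : Monotone (noisePast X Z ε) :=
  fun _ _ h => sup_le_sup_left
    (biSup_mono fun _ hg => Finset.Icc_subset_Icc_right h hg) _

lemma comap_sup_comap_le_noisePast {Ω : Type*} (X : Ω → ℝ) (Z ε : ℕ → Ω → ℝ) {n : ℕ}
    (hn : 2 ≤ n) :
    MeasurableSpace.comap (Z n) inferInstance ⊔ MeasurableSpace.comap (ε n) inferInstance
      ≤ noisePast X Z ε n :=
  le_sup_of_le_right <| le_iSup₂_of_le n (Finset.mem_Icc.2 ⟨hn, le_rfl⟩) le_rfl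

/-- An autoregressive process is adapted to the σ-algebras generated by its noise. -/
lemma measurable_noisePast_of_recursion {Ω : Type*} (Z ε W : ℕ → Ω → ℝ) (c : ℝ)
    (hW : ∀ n, 1 ≤ n → W (n + 1) = fun ω => (c * Z (n + 1) ω + W n ω) + ε (n + 1) ω)
    {n : ℕ} (hn : 1 ≤ n) : Measurable[noisePast (W 1) Z ε n] (W n) := by
  induction n, hn using Nat.le_induction with
  | base => exact measurable_iff_comap_le.2 le_sup_left
  | succ n hn ih =>
    have hle := comap_sup_comap_le_noisePast (W 1) Z ε (n := n + 1) (by lia)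
    have hZ : Measurable[noisePast (W 1) Z ε (n + 1)] (Z (n + 1)) :=
      measurable_iff_comap_le.2 (le_sup_left.trans hle)
    have hε : Measurable[noisePast (W 1) Z ε (n + 1)] (ε (n + 1)) :=
      measurable_iff_comap_le.2 (le_sup_right.trans hle)
    have hWn := ih.mono (noisePast_mono (W 1) Z ε n.le_succ) le_rfl
    rw [hW n hn]
    exact ((hZ.const_mul c).add hWn).add hε

/-- **Discard workflow: linearly exploding variance of the limiting Gaussian process.**
Let `v_T > 0` and `v_Θ ≥ 1/v_T`.  The limit process is defined recursively by
`W_Θ(1) ~ N(0, v_Θ)` and, for `G ≥ 2`, `W_T(G) = Z_G + v_T·W_Θ(G−1)` with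
`Z_G ~ N(0, v_T)` independent of `(Z_2,…,Z_{G−1}, ε_2,…,ε_{G−1}, W_Θ(1))`, and
`W_Θ(G) = v_T⁻¹·W_T(G) + ε_G` with `ε_G ~ N(0, v_Θ − v_T⁻¹)` independent of
`(Z_2,…,Z_G, ε_2,…,ε_{G−1}, W_Θ(1))`.  Then `Var(W_Θ(G)) = G·v_Θ` for every `G ≥ 1`,
so the asymptotic relative efficiency `Var(W_Θ(1))/Var(W_Θ(G))` equals `1/G` and
tends to `0` as `G → ∞`. -/
theorem discard_limit_variance_explodes
    {Ω : Type*} [MeasurableSpace Ω] (P : Measure Ω) [IsProbabilityMeasure P]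
    (vT vΘ : ℝ) (hvT : 0 < vT) (hvΘ : 1 / vT ≤ vΘ)
    (Z ε WT WΘ : ℕ → Ω → ℝ)
    (hZmeas : ∀ G, Measurable (Z G)) (hεmeas : ∀ G, Measurable (ε G))
    (hWΘmeas : ∀ G, Measurable (WΘ G))
    (hW1law : P.map (WΘ 1) = gaussianReal 0 vΘ.toNNReal)
    (hZlaw : ∀ G, 2 ≤ G → P.map (Z G) = gaussianReal 0 vT.toNNReal)
    (hεlaw : ∀ G, 2 ≤ G → P.map (ε G) = gaussianReal 0 (vΘ - vT⁻¹).toNNReal)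
    (hWT : ∀ G, 2 ≤ G → WT G = fun ω => Z G ω + vT * WΘ (G - 1) ω)
    (hWΘ : ∀ G, 2 ≤ G → WΘ G = fun ω => vT⁻¹ * WT G ω + ε G ω)
    (hZindep : ∀ G, 2 ≤ G →
      Indep (MeasurableSpace.comap (Z G) inferInstance)
        ((MeasurableSpace.comap (WΘ 1) inferInstance) ⊔
          ⨆ g ∈ Finset.Icc 2 (G - 1),
            (MeasurableSpace.comap (Z g) inferInstance ⊔
              MeasurableSpace.comap (ε g) inferInstance)) P)
    (hεindep : ∀ G, 2 ≤ G →
      Indep (MeasurableSpace.comap (ε G) inferInstance)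
        ((MeasurableSpace.comap (WΘ 1) inferInstance) ⊔
          (MeasurableSpace.comap (Z G) inferInstance) ⊔
          ⨆ g ∈ Finset.Icc 2 (G - 1),
            (MeasurableSpace.comap (Z g) inferInstance ⊔
              MeasurableSpace.comap (ε g) inferInstance)) P) :
    (∀ G : ℕ, 1 ≤ G → variance (WΘ G) P = G * vΘ) ∧
    (∀ G : ℕ, 1 ≤ G → variance (WΘ 1) P / variance (WΘ G) P = 1 / G) ∧
    Tendsto (fun G : ℕ => variance (WΘ 1) P / variance (WΘ G) P) atTop (𝓝 0) := by
  have hvΘ0 : 0 < vΘ := (one_div_pos.2 hvT).trans_le hvΘ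
  have hrec : ∀ n, 1 ≤ n →
      WΘ (n + 1) = fun ω => (vT⁻¹ * Z (n + 1) ω + WΘ n ω) + ε (n + 1) ω := by
    intro n hn
    rw [hWΘ (n + 1) (by lia), hWT (n + 1) (by lia)]
    funext ω
    simp only [Nat.add_sub_cancel]
    field_simp
  have hvar : ∀ G : ℕ, 1 ≤ G → MemLp (WΘ G) 2 P ∧ variance (WΘ G) P = G * vΘ := by
    intro G hG
    induction G, hG using Nat.le_induction with
    | base =>
      refine ⟨memLp_two_of_map_eq_gaussianReal (hWΘmeas 1) hW1law, ?_⟩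
      rw [variance_of_map_eq_gaussianReal (hWΘmeas 1) hW1law, Real.coe_toNNReal _ hvΘ0.le]
      simp
    | succ n hn ih =>
      obtain ⟨hWL, hWvar⟩ := ih
      have h2 : 2 ≤ n + 1 := by lia
      have hZL := (memLp_two_of_map_eq_gaussianReal (hZmeas _) (hZlaw _ h2)).const_mul vT⁻¹
      have hεL := memLp_two_of_map_eq_gaussianReal (hεmeas _) (hεlaw _ h2)
      have hWpast := measurable_noisePast_of_recursion Z ε WΘ vT⁻¹ hrec hn
      have hindZ : IndepFun (fun ω => vT⁻¹ * Z (n + 1) ω) (WΘ n) P := by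
        have h : IndepFun (Z (n + 1)) (WΘ n) P :=
          (IndepFun_iff_Indep _ _ _).2 <|
            indep_of_indep_of_le_right (hZindep _ h2) hWpast.comap_le
        exact h.comp (measurable_const_mul vT⁻¹) measurable_id
      have hindε : IndepFun (fun ω => vT⁻¹ * Z (n + 1) ω + WΘ n ω) (ε (n + 1)) P := by
        refine ((IndepFun_iff_Indep _ _ _).2 <|
          indep_of_indep_of_le_right (hεindep _ h2) (Measurable.comap_le ?_)).symm
        refine Measurable.add (Measurable.const_mul ?_ _) (hWpast.mono ?_ le_rfl)
        · exact measurable_iff_comap_le.2 (le_sup_of_le_left le_sup_right)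
        · exact sup_le_sup_right le_sup_left _
      have hsumL : MemLp (fun ω => vT⁻¹ * Z (n + 1) ω + WΘ n ω) 2 P := hZL.add hWL
      rw [hrec n hn]
      refine ⟨hsumL.add hεL, ?_⟩
      rw [hindε.variance_fun_add hsumL hεL, hindZ.variance_fun_add hZL hWL,
        variance_const_mul, hWvar, variance_of_map_eq_gaussianReal (hZmeas _) (hZlaw _ h2),
        variance_of_map_eq_gaussianReal (hεmeas _) (hεlaw _ h2), Real.coe_toNNReal _ hvT.le,
        Real.coe_toNNReal _ (by rw [← one_div]; linarith)]
      push_cast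
      field_simp
      ring
  have hratio : ∀ G : ℕ, 1 ≤ G → variance (WΘ 1) P / variance (WΘ G) P = 1 / G := by
    intro G hG
    have hG0 : (G : ℝ) ≠ 0 := by positivity
    rw [(hvar 1 le_rfl).2, (hvar G hG).2]
    field_simp
    simp
  refine ⟨fun G hG => (hvar G hG).2, hratio, ?_⟩
  refine tendsto_one_div_atTop_nhds_zero_nat.congr' ?_
  filter_upwards [eventually_ge_atTop 1] with G hG
  exact (hratio G hG).symm
end

section
/- Under the augment workflow, the limiting Gaussian process has variance bounded by π²/6 times the initial variance: let v_T > 0 and v_Θ ≥ 1/v_T be real numbers, and on a probability space define real-valued random variables recursively by W_Θ(1) ~ N(0, v_Θ), and for each G ≥ 2: W_T(G) = Z_G + v_T·W_Θ(G−1) where Z_G ~ N(0, v_T) is independent of all previously constructed variables, and W_Θ(G) = (1/G)·v_T^{−1}·W_T(G) + ((G−1)/G)·W_Θ(G−1) + ε_G where ε_G ~ N(0, (v_Θ − v_T^{−1})/G²) is independent of all previously constructed variables. Then for every G ≥ 1, Var(W_Θ(G)) = v_Θ·∑_{g=1}^{G} 1/g² ≤ (π²/6)·v_Θ; consequently the asymptotic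 relative efficiency ARE(G) := Var(W_Θ(1))/Var(W_Θ(G)) = (∑_{g=1}^{G} 1/g²)^{−1} ≥ 6/π² for every G ≥ 1. -/
open MeasureTheory ProbabilityTheory Filter
open scoped ENNReal NNReal Topology

/-- A random variable with a centered Gaussian law is square integrable, and its variance is the
variance parameter of the law. -/
lemma memLp_two_and_variance_of_map_eq_gaussianReal {Ω : Type*} [MeasurableSpace Ω]
    {P : Measure Ω} {X : Ω → ℝ} {v : ℝ} (hX : Measurable X) (hv : 0 ≤ v)
    (hlaw : P.map X = gaussianReal 0 v.toNNReal) :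
    MemLp X 2 P ∧ variance X P = v := by
  constructor
  · have h := memLp_id_gaussianReal (μ := 0) (v := v.toNNReal) 2
    rw [← hlaw] at h
    simpa using (memLp_map_measure_iff aestronglyMeasurable_id hX.aemeasurable).1 h
  · rw [← variance_id_map hX.aemeasurable, hlaw, variance_id_gaussianReal, Real.coe_toNNReal v hv]

/-- Variances add when one summand is independent of a σ-algebra for which the other is
measurable. -/
lemma variance_add_of_indep_comap {Ω : Type*} [MeasurableSpace Ω] {P : Measure Ω}
    [IsProbabilityMeasure P] {X Y : Ω → ℝ} {m : MeasurableSpace Ω}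
    (hX : MemLp X 2 P) (hY : MemLp Y 2 P)
    (hind : Indep (MeasurableSpace.comap X inferInstance) m P) (hYm : Measurable[m] Y) :
    variance (X + Y) P = variance X P + variance Y P :=
  IndepFun.variance_add hX hY
    ((IndepFun_iff_Indep X Y P).2 (indep_of_indep_of_le_right hind hYm.comap_le))

/-- The partial sums of the Basel series are bounded by its value. -/
lemma sum_Icc_one_div_sq_le (G : ℕ) :
    ∑ g ∈ Finset.Icc 1 G, 1 / (g : ℝ) ^ 2 ≤ Real.pi ^ 2 / 6 :=
  sum_le_hasSum _ (fun _ _ => by positivity) hasSum_zeta_two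

/-- **Augment workflow: the variance of the limiting Gaussian process is bounded by
`π²/6` times the initial variance.**  Let `v_T > 0` and `v_Θ ≥ 1/v_T`.  The limit process
is defined recursively by `W_Θ(1) ~ N(0, v_Θ)` and, for `G ≥ 2`,
`W_T(G) = Z_G + v_T·W_Θ(G−1)` with `Z_G ~ N(0, v_T)` independent of all previously
constructed variables, and
`W_Θ(G) = (1/G)·v_T⁻¹·W_T(G) + ((G−1)/G)·W_Θ(G−1) + ε_G` with
`ε_G ~ N(0, (v_Θ − v_T⁻¹)/G²)` independent of all previously constructed variables.
Then for every `G ≥ 1`, `Var(W_Θ(G)) = v_Θ·∑_{g=1}^{G} 1/g² ≤ (π²/6)·v_Θ`, and the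
asymptotic relative efficiency `Var(W_Θ(1))/Var(W_Θ(G)) = (∑_{g=1}^{G} 1/g²)⁻¹ ≥ 6/π²`. -/
theorem augment_limit_variance_bounded
    {Ω : Type*} [MeasurableSpace Ω] (P : Measure Ω) [IsProbabilityMeasure P]
    (vT vΘ : ℝ) (hvT : 0 < vT) (hvΘ : 1 / vT ≤ vΘ)
    (Z ε WT WΘ : ℕ → Ω → ℝ)
    (hZmeas : ∀ G, Measurable (Z G)) (hεmeas : ∀ G, Measurable (ε G))
    (hWΘmeas : ∀ G, Measurable (WΘ G))
    (hW1law : P.map (WΘ 1) = gaussianReal 0 vΘ.toNNReal)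
    (hZlaw : ∀ G, 2 ≤ G → P.map (Z G) = gaussianReal 0 vT.toNNReal)
    (hεlaw : ∀ G : ℕ, 2 ≤ G →
      P.map (ε G) = gaussianReal 0 ((vΘ - vT⁻¹) / (G : ℝ) ^ 2).toNNReal)
    (hWT : ∀ G, 2 ≤ G → WT G = fun ω => Z G ω + vT * WΘ (G - 1) ω)
    (hWΘ : ∀ G : ℕ, 2 ≤ G → WΘ G = fun ω =>
      (1 / (G : ℝ)) * vT⁻¹ * WT G ω + (((G : ℝ) - 1) / (G : ℝ)) * WΘ (G - 1) ω + ε G ω)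
    (hZindep : ∀ G, 2 ≤ G →
      Indep (MeasurableSpace.comap (Z G) inferInstance)
        ((MeasurableSpace.comap (WΘ 1) inferInstance) ⊔
          ⨆ g ∈ Finset.Icc 2 (G - 1),
            (MeasurableSpace.comap (Z g) inferInstance ⊔
              MeasurableSpace.comap (ε g) inferInstance)) P)
    (hεindep : ∀ G, 2 ≤ G →
      Indep (MeasurableSpace.comap (ε G) inferInstance)
        ((MeasurableSpace.comap (WΘ 1) inferInstance) ⊔
          (MeasurableSpace.comap (Z G) inferInstance) ⊔
          ⨆ g ∈ Finset.Icc 2 (G - 1),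
            (MeasurableSpace.comap (Z g) inferInstance ⊔
              MeasurableSpace.comap (ε g) inferInstance)) P) :
    (∀ G : ℕ, 1 ≤ G →
      variance (WΘ G) P = vΘ * ∑ g ∈ Finset.Icc 1 G, 1 / (g : ℝ) ^ 2 ∧
      variance (WΘ G) P ≤ Real.pi ^ 2 / 6 * vΘ) ∧
    (∀ G : ℕ, 1 ≤ G →
      variance (WΘ 1) P / variance (WΘ G) P = (∑ g ∈ Finset.Icc 1 G, 1 / (g : ℝ) ^ 2)⁻¹ ∧
      6 / Real.pi ^ 2 ≤ variance (WΘ 1) P / variance (WΘ G) P) := by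
  have hinv : 0 < vT⁻¹ := inv_pos.2 hvT
  have hle : vT⁻¹ ≤ vΘ := by simpa using hvΘ
  have hvΘpos : 0 < vΘ := hinv.trans_le hle
  have hrec : ∀ G : ℕ, 2 ≤ G →
      WΘ G = ε G + (fun ω => (1 / (G : ℝ) * vT⁻¹) * Z G ω) + WΘ (G - 1) := by
    intro G hG
    have hG0 : (G : ℝ) ≠ 0 := by positivity
    rw [hWΘ G hG, hWT G hG]
    funext ω
    simp only [Pi.add_apply]
    field_simp
    ring
  have key : ∀ G : ℕ, 1 ≤ G →
      Measurable[(MeasurableSpace.comap (WΘ 1) inferInstance) ⊔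
          ⨆ g ∈ Finset.Icc 2 G,
            (MeasurableSpace.comap (Z g) inferInstance ⊔
              MeasurableSpace.comap (ε g) inferInstance)] (WΘ G) ∧
      MemLp (WΘ G) 2 P ∧
      variance (WΘ G) P = vΘ * ∑ g ∈ Finset.Icc 1 G, 1 / (g : ℝ) ^ 2 := by
    intro G hG
    induction G, hG using Nat.le_induction with
    | base =>
      obtain ⟨hL, hvar⟩ :=
        memLp_two_and_variance_of_map_eq_gaussianReal (hWΘmeas 1) hvΘpos.le hW1law
      exact ⟨(comap_measurable (WΘ 1)).mono le_sup_left le_rfl, hL, by simp [hvar]⟩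
    | succ n hn ih =>
      obtain ⟨hm, hL, hvar⟩ := ih
      have h2 : 2 ≤ n + 1 := by omega
      obtain ⟨hZL, hZvar⟩ :=
        memLp_two_and_variance_of_map_eq_gaussianReal (hZmeas (n + 1)) hvT.le (hZlaw _ h2)
      obtain ⟨hεL, hεvar⟩ :=
        memLp_two_and_variance_of_map_eq_gaussianReal (hεmeas (n + 1))
          (div_nonneg (sub_nonneg.2 hle) (by positivity)) (hεlaw _ h2)
      have hZi := hZindep _ h2
      have hεi := hεindep _ h2
      have hr := hrec _ h2
      rw [Nat.add_sub_cancel] at hZi hεi hr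
      set c : ℝ := 1 / ((n + 1 : ℕ) : ℝ) * vT⁻¹ with hc
      have hcL : MemLp (fun ω => c * Z (n + 1) ω) 2 P := hZL.const_mul c
      have hci : Indep (MeasurableSpace.comap (fun ω => c * Z (n + 1) ω) inferInstance) _ P :=
        indep_of_indep_of_le_left hZi
          ((comap_measurable (Z (n + 1))).const_mul c).comap_le
      have hmono : (⨆ g ∈ Finset.Icc 2 n, (MeasurableSpace.comap (Z g) inferInstance ⊔
              MeasurableSpace.comap (ε g) inferInstance)) ≤
          ⨆ g ∈ Finset.Icc 2 (n + 1), (MeasurableSpace.comap (Z g) inferInstance ⊔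
              MeasurableSpace.comap (ε g) inferInstance) :=
        biSup_mono fun g hg => Finset.Icc_subset_Icc_right n.le_succ hg
      have hlast : MeasurableSpace.comap (Z (n + 1)) inferInstance ⊔
            MeasurableSpace.comap (ε (n + 1)) inferInstance ≤
          ⨆ g ∈ Finset.Icc 2 (n + 1), (MeasurableSpace.comap (Z g) inferInstance ⊔
              MeasurableSpace.comap (ε g) inferInstance) :=
        le_iSup₂_of_le (n + 1) (Finset.mem_Icc.2 ⟨h2, le_rfl⟩) le_rfl
      have hsum := variance_add_of_indep_comap hcL hL hci hm
      have hsum' := variance_add_of_indep_comap hεL (hcL.add hL) hεi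
        (Measurable.add
          (((comap_measurable (Z (n + 1))).const_mul c).mono
            (le_sup_right.trans le_sup_left) le_rfl)
          (hm.mono (sup_le (le_sup_left.trans le_sup_left) le_sup_right) le_rfl))
      refine ⟨?_, ?_, ?_⟩
      · rw [hr]
        exact Measurable.add (Measurable.add
          ((comap_measurable (ε (n + 1))).mono
            ((le_sup_right.trans hlast).trans le_sup_right) le_rfl)
          (((comap_measurable (Z (n + 1))).const_mul c).mono
            ((le_sup_left.trans hlast).trans le_sup_right) le_rfl))
          (hm.mono (sup_le_sup le_rfl hmono) le_rfl)
      · rw [hr]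
        exact (hεL.add hcL).add hL
      · rw [hr, add_assoc, hsum', hsum, variance_const_mul, hZvar, hεvar, hvar,
          Finset.sum_Icc_succ_top (by omega), hc]
        field_simp
        ring
  have hvar1 : variance (WΘ 1) P = vΘ := by simpa using (key 1 le_rfl).2.2
  refine ⟨fun G hG => ⟨(key G hG).2.2, ?_⟩, fun G hG => ?_⟩
  · rw [(key G hG).2.2, mul_comm]
    exact mul_le_mul_of_nonneg_right (sum_Icc_one_div_sq_le G) hvΘpos.le
  · have hratio : variance (WΘ 1) P / variance (WΘ G) P =
        (∑ g ∈ Finset.Icc 1 G, 1 / (g : ℝ) ^ 2)⁻¹ := by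
      rw [hvar1, (key G hG).2.2, div_mul_cancel_left₀ hvΘpos.ne']
    have hpos : 0 < ∑ g ∈ Finset.Icc 1 G, 1 / (g : ℝ) ^ 2 :=
      Finset.sum_pos (fun g hg => by
        have : 0 < g := (Finset.mem_Icc.1 hg).1
        positivity) (Finset.nonempty_Icc.2 hG)
    refine ⟨hratio, ?_⟩
    rw [hratio, ← inv_div]
    exact inv_anti₀ hpos (sum_Icc_one_div_sq_le G)
end

section
/- Le Cam's Third Lemma: for each N let P_N and Q_N be probability measures on a measurable space (Ω_N, 𝔉_N) with Q_N ≪ P_N and Q_N contiguous to P_N, let L_N = dQ_N/dP_N be the Radon–Nikodym derivative, and let R_N be a real-valued measurable function on Ω_N. Suppose there is a probability measure F on ℝ² such that for every bounded continuous g: ℝ² → ℝ, ∫ g(R_N, L_N) dP_N → ∫ g(r, ℓ) dF(r, ℓ) as N → ∞. Then for every bounded continuous g: ℝ² → ℝ, ∫ g(R_N, L_N) dQ_N → ∫ g(r, ℓ)·ℓ dF(r, ℓ) as N → ∞. -/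
open MeasureTheory Filter
open scoped ENNReal NNReal Topology

/-- Markov's inequality for the density of a probability measure. -/
theorem measure_natCast_lt_toReal_rnDeriv_le {Ω : Type*} [MeasurableSpace Ω]
    (P Q : Measure Ω) [IsProbabilityMeasure Q] (k : ℕ) :
    P {ω | (k : ℝ) < (Q.rnDeriv P ω).toReal} ≤ (k : ℝ≥0∞)⁻¹ := by
  rcases Nat.eq_zero_or_pos k with rfl | hk
  · simp
  have hsub : {ω | (k : ℝ) < (Q.rnDeriv P ω).toReal} ⊆ {ω | (k : ℝ≥0∞) ≤ Q.rnDeriv P ω} := by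
    intro ω hω
    have h := (ENNReal.ofReal_lt_iff_lt_toReal (Nat.cast_nonneg k) ?_).2 hω
    · rw [ENNReal.ofReal_natCast] at h
      exact h.le
    · intro h
      have hω' : (k : ℝ) < (Q.rnDeriv P ω).toReal := hω
      rw [h, ENNReal.toReal_top] at hω'
      exact absurd hω' (not_lt.2 (Nat.cast_nonneg k))
  calc P {ω | (k : ℝ) < (Q.rnDeriv P ω).toReal}
      ≤ P {ω | (k : ℝ≥0∞) ≤ Q.rnDeriv P ω} := measure_mono hsub
    _ ≤ (∫⁻ ω, Q.rnDeriv P ω ∂P) / k :=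
        meas_ge_le_lintegral_div (Q.measurable_rnDeriv P).aemeasurable
          (by exact_mod_cast hk.ne') (ENNReal.natCast_ne_top k)
    _ ≤ 1 / k := by
        gcongr
        exact (Measure.lintegral_rnDeriv_le).trans_eq measure_univ
    _ = (k : ℝ≥0∞)⁻¹ := one_div _

/-- Under contiguity the likelihood ratios are tight under the alternatives. -/
theorem exists_eventually_measure_natCast_lt_toReal_rnDeriv_le
    {Ω : ℕ → Type*} [∀ N, MeasurableSpace (Ω N)] (P Q : ∀ N, Measure (Ω N))
    [∀ N, IsProbabilityMeasure (Q N)]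
    (hcontig : ∀ A : (N : ℕ) → Set (Ω N), (∀ N, MeasurableSet (A N)) →
      Tendsto (fun N => P N (A N)) atTop (𝓝 0) →
      Tendsto (fun N => Q N (A N)) atTop (𝓝 0))
    {ε : ℝ≥0∞} (hε : 0 < ε) :
    ∃ K : ℕ, ∀ᶠ N in atTop, Q N {ω | (K : ℝ) < ((Q N).rnDeriv (P N) ω).toReal} ≤ ε := by
  by_contra! h
  obtain ⟨φ, hφ, hQ⟩ := extraction_forall_of_frequently
    (P := fun k N => ε < Q N {ω | (k : ℝ) < ((Q N).rnDeriv (P N) ω).toReal}) h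
  let A (N : ℕ) : Set (Ω N) :=
    ⋃ k : ℕ, ⋃ _ : φ k = N, {ω | (k : ℝ) < ((Q N).rnDeriv (P N) ω).toReal}
  have hA (N : ℕ) : MeasurableSet (A N) :=
    .iUnion fun k => .iUnion fun _ =>
      measurableSet_lt measurable_const ((Q N).measurable_rnDeriv (P N)).ennreal_toReal
  have hPA : Tendsto (fun N => P N (A N)) atTop (𝓝 0) := by
    refine ENNReal.tendsto_nhds_zero.2 fun δ hδ => ?_
    obtain ⟨m, hm⟩ := ENNReal.exists_inv_nat_lt hδ.ne'
    filter_upwards [eventually_ge_atTop (φ m)] with N hN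
    refine le_trans (measure_mono ?_)
      ((measure_natCast_lt_toReal_rnDeriv_le (P N) (Q N) m).trans hm.le)
    refine Set.iUnion₂_subset fun k hk ω (hω : (k : ℝ) < _) => ?_
    have hmk : m ≤ k := hφ.le_iff_le.1 (hN.trans_eq hk.symm)
    exact lt_of_le_of_lt (Nat.cast_le.2 hmk) hω
  have hQA := (hcontig A hA hPA).comp hφ.tendsto_atTop
  obtain ⟨k, hk⟩ := ((ENNReal.tendsto_nhds_zero.1 hQA) ε hε).exists
  refine absurd hk (not_le.2 ((hQ k).trans_le (measure_mono ?_)))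
  exact Set.subset_iUnion₂_of_subset k rfl subset_rfl

/-- Truncation of the second coordinate to `[0, K]`. -/
noncomputable def truncSnd (K : ℕ) : BoundedContinuousFunction (ℝ × ℝ) ℝ :=
  BoundedContinuousFunction.ofNormedAddCommGroup (fun p => max 0 (min p.2 K)) (by fun_prop) K
    fun p => by
      rw [Real.norm_of_nonneg (le_max_left _ _)]
      exact max_le (Nat.cast_nonneg K) (min_le_right _ _)

theorem truncSnd_apply (K : ℕ) (p : ℝ × ℝ) : truncSnd K p = max 0 (min p.2 K) := rfl

theorem truncSnd_nonneg (K : ℕ) (p : ℝ × ℝ) : 0 ≤ truncSnd K p := le_max_left _ _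

theorem truncSnd_le_snd (K : ℕ) {p : ℝ × ℝ} (hp : 0 ≤ p.2) : truncSnd K p ≤ p.2 :=
  max_le hp (min_le_left _ _)

theorem tendsto_truncSnd {p : ℝ × ℝ} (hp : 0 ≤ p.2) :
    Tendsto (fun K => truncSnd K p) atTop (𝓝 p.2) := by
  refine tendsto_const_nhds.congr' ?_
  filter_upwards [tendsto_natCast_atTop_atTop.eventually_ge_atTop p.2] with K hK
  rw [truncSnd_apply, min_eq_left hK, max_eq_right hp]

/-- Replacing the likelihood ratio by its truncation at `K` costs at most `‖g‖ Q(L > K)`. -/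
theorem abs_integral_sub_integral_mul_truncSnd_le {Ω : Type*} [MeasurableSpace Ω]
    (P Q : Measure Ω) [IsProbabilityMeasure P] [IsProbabilityMeasure Q] (hQP : Q ≪ P)
    {R : Ω → ℝ} (hR : Measurable R) (g : BoundedContinuousFunction (ℝ × ℝ) ℝ) (K : ℕ) :
    |∫ ω, g (R ω, (Q.rnDeriv P ω).toReal) ∂Q -
        ∫ ω, (g * truncSnd K) (R ω, (Q.rnDeriv P ω).toReal) ∂P| ≤
      ‖g‖ * Q.real {ω | (K : ℝ) < (Q.rnDeriv P ω).toReal} := by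
  set L : Ω → ℝ := fun ω => (Q.rnDeriv P ω).toReal
  have hL : Measurable L := (Q.measurable_rnDeriv P).ennreal_toReal
  have hL0 (ω : Ω) : 0 ≤ L ω := ENNReal.toReal_nonneg
  have hLint : Integrable L P := Measure.integrable_toReal_rnDeriv
  have hX : Measurable fun ω => (R ω, L ω) := hR.prodMk hL
  have hS : MeasurableSet {ω | (K : ℝ) < L ω} := measurableSet_lt measurable_const hL
  have hint1 : Integrable (fun ω => L ω * g (R ω, L ω)) P :=
    hLint.mul_bdd (c := ‖g‖) (g.continuous.measurable.comp hX).aestronglyMeasurable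
      (.of_forall fun ω => g.norm_coe_le_norm _)
  have hint2 : Integrable (fun ω => (g * truncSnd K) (R ω, L ω)) P :=
    .of_bound ((g * truncSnd K).continuous.measurable.comp hX).aestronglyMeasurable
      ‖g * truncSnd K‖ (.of_forall fun ω => (g * truncSnd K).norm_coe_le_norm _)
  have hchange (f : Ω → ℝ) : ∫ ω, f ω ∂Q = ∫ ω, L ω * f ω ∂P :=
    (integral_rnDeriv_smul hQP).symm
  have hQS : Q.real {ω | (K : ℝ) < L ω} = ∫ ω, {ω | (K : ℝ) < L ω}.indicator L ω ∂P := by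
    rw [← integral_indicator_one hS, hchange]
    congr 1 with ω
    by_cases h : ω ∈ {ω | (K : ℝ) < L ω} <;> simp [h]
  rw [hchange, ← integral_sub hint1 hint2, hQS, ← integral_const_mul, ← Real.norm_eq_abs]
  refine norm_integral_le_of_norm_le ((hLint.indicator hS).const_mul _) (.of_forall fun ω => ?_)
  have hfac : L ω * g (R ω, L ω) - (g * truncSnd K) (R ω, L ω) =
      g (R ω, L ω) * (L ω - truncSnd K (R ω, L ω)) := by
    rw [BoundedContinuousFunction.mul_apply]
    ring
  rw [hfac, norm_mul]
  refine mul_le_mul (g.norm_coe_le_norm _) ?_ (norm_nonneg _) (norm_nonneg _)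
  rw [Real.norm_of_nonneg (sub_nonneg.2 (truncSnd_le_snd K (p := (R ω, L ω)) (hL0 ω)))]
  by_cases h : (K : ℝ) < L ω
  · rw [Set.indicator_of_mem (show ω ∈ {ω | (K : ℝ) < L ω} from h)]
    linarith [truncSnd_nonneg K (R ω, L ω)]
  · rw [Set.indicator_of_notMem (show ω ∉ {ω | (K : ℝ) < L ω} from h), truncSnd_apply,
      min_eq_left (not_lt.1 h), max_eq_right (hL0 ω), sub_self]

/-- Weak limits of laws with nonnegative second coordinate have nonnegative second coordinate. -/
theorem ae_snd_nonneg_of_tendsto {Ω : ℕ → Type*} [∀ N, MeasurableSpace (Ω N)]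
    (P : ∀ N, Measure (Ω N)) {R L : ∀ N, Ω N → ℝ} (hL : ∀ N ω, 0 ≤ L N ω)
    (F : Measure (ℝ × ℝ)) [IsFiniteMeasure F]
    (hconv : ∀ g : BoundedContinuousFunction (ℝ × ℝ) ℝ,
      Tendsto (fun N => ∫ ω, g (R N ω, L N ω) ∂(P N)) atTop (𝓝 (∫ p, g p ∂F))) :
    ∀ᵐ p ∂F, 0 ≤ p.2 := by
  let h : BoundedContinuousFunction (ℝ × ℝ) ℝ :=
    BoundedContinuousFunction.ofNormedAddCommGroup (fun p => max 0 (min (-p.2) 1))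
      (by fun_prop) 1 fun p => by
        rw [Real.norm_of_nonneg (le_max_left _ _)]
        exact max_le zero_le_one (min_le_right _ _)
  have h_apply (p : ℝ × ℝ) : h p = max 0 (min (-p.2) 1) := rfl
  have hzero (N : ℕ) : ∫ ω, h (R N ω, L N ω) ∂(P N) = 0 := by
    refine integral_eq_zero_of_ae (.of_forall fun ω => ?_)
    exact max_eq_left ((min_le_left _ _).trans (neg_nonpos.2 (hL N ω)))
  have hF : ∫ p, h p ∂F = 0 :=
    tendsto_nhds_unique (hconv h) (by simp only [hzero]; exact tendsto_const_nhds)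
  have hae := (integral_eq_zero_iff_of_nonneg (fun p => le_max_left _ _) (h.integrable F)).1 hF
  filter_upwards [hae] with p hp
  by_contra! hneg
  have hpos : 0 < h p := lt_max_of_lt_right (lt_min (neg_pos.2 hneg) one_pos)
  exact hpos.ne' hp

/-- The second coordinate is integrable as soon as its truncations have bounded integrals. -/
theorem integrable_snd_of_integral_truncSnd_le (F : Measure (ℝ × ℝ)) [IsFiniteMeasure F]
    (hF : ∀ᵐ p ∂F, 0 ≤ p.2) (C : ℝ) (hC : ∀ K, ∫ p, truncSnd K p ∂F ≤ C) :
    Integrable (fun p : ℝ × ℝ => p.2) F := by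
  refine ⟨measurable_snd.aestronglyMeasurable, ?_⟩
  rw [hasFiniteIntegral_iff_ofReal hF]
  have hlim : Tendsto (fun K => ∫⁻ p, ENNReal.ofReal (truncSnd K p) ∂F) atTop
      (𝓝 (∫⁻ p, ENNReal.ofReal p.2 ∂F)) := by
    refine lintegral_tendsto_of_tendsto_of_monotone
      (fun K => (truncSnd K).continuous.measurable.ennreal_ofReal.aemeasurable)
      (.of_forall fun p K M hKM => ?_) ?_
    · refine ENNReal.ofReal_le_ofReal (max_le_max_left _ (min_le_min_left _ ?_))
      exact_mod_cast hKM
    · filter_upwards [hF] with p hp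
      exact (ENNReal.continuous_ofReal.tendsto _).comp (tendsto_truncSnd hp)
  refine lt_of_le_of_lt (le_of_tendsto' hlim fun K => ?_) (ENNReal.ofReal_lt_top (r := C))
  rw [← ofReal_integral_eq_lintegral_ofReal ((truncSnd K).integrable F)
    (.of_forall fun p => truncSnd_nonneg K p)]
  exact ENNReal.ofReal_le_ofReal (hC K)

/-- **Le Cam's Third Lemma.**  For each `N` let `P_N`, `Q_N` be probability measures with
`Q_N ≪ P_N`, `Q_N` contiguous to `P_N`, `L_N = dQ_N/dP_N`, and `R_N` a real-valued
measurable function.  If the joint law of `(R_N, L_N)` under `P_N` converges weakly to a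
probability measure `F` on `ℝ²`, then the joint law of `(R_N, L_N)` under `Q_N`
converges weakly to the measure with `F`-density `(r, ℓ) ↦ ℓ`: for every bounded
continuous `g`, `∫ g(R_N, L_N) dQ_N → ∫ g(r, ℓ)·ℓ dF(r, ℓ)`. -/
theorem le_cam_third_lemma
    {Ω : ℕ → Type*} [∀ N, MeasurableSpace (Ω N)]
    (P Q : ∀ N, Measure (Ω N))
    [∀ N, IsProbabilityMeasure (P N)] [∀ N, IsProbabilityMeasure (Q N)]
    (habs : ∀ N, Q N ≪ P N)
    (hcontig : ∀ A : (N : ℕ) → Set (Ω N), (∀ N, MeasurableSet (A N)) →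
      Tendsto (fun N => P N (A N)) atTop (𝓝 0) →
      Tendsto (fun N => Q N (A N)) atTop (𝓝 0))
    (R : ∀ N, Ω N → ℝ) (hR : ∀ N, Measurable (R N))
    (F : Measure (ℝ × ℝ)) [IsProbabilityMeasure F]
    (hconv : ∀ g : BoundedContinuousFunction (ℝ × ℝ) ℝ,
      Tendsto
        (fun N => ∫ ω, g (R N ω, (((Q N).rnDeriv (P N)) ω).toReal) ∂(P N)) atTop
        (𝓝 (∫ p, g p ∂F))) :
    ∀ g : BoundedContinuousFunction (ℝ × ℝ) ℝ,
      Tendsto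
        (fun N => ∫ ω, g (R N ω, (((Q N).rnDeriv (P N)) ω).toReal) ∂(Q N)) atTop
        (𝓝 (∫ p, g p * p.2 ∂F)) := by
  intro g
  have hF := ae_snd_nonneg_of_tendsto P (fun N ω => ENNReal.toReal_nonneg) F hconv
  have hbound (K : ℕ) : ∫ p, truncSnd K p ∂F ≤ 1 := by
    refine le_of_tendsto' (hconv (truncSnd K)) fun N => ?_
    calc ∫ ω, truncSnd K (R N ω, ((Q N).rnDeriv (P N) ω).toReal) ∂(P N)
        ≤ ∫ ω, ((Q N).rnDeriv (P N) ω).toReal ∂(P N) :=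
          integral_mono_of_nonneg (.of_forall fun ω => truncSnd_nonneg K _)
            Measure.integrable_toReal_rnDeriv
            (.of_forall fun ω => truncSnd_le_snd K ENNReal.toReal_nonneg)
      _ = 1 := by rw [Measure.integral_toReal_rnDeriv (habs N), probReal_univ]
  have hFint := integrable_snd_of_integral_truncSnd_le F hF 1 hbound
  have hlim : Tendsto (fun K : ℕ => ∫ p, (g * truncSnd K) p ∂F) atTop
      (𝓝 (∫ p, g p * p.2 ∂F)) := by
    refine tendsto_integral_of_dominated_convergence (fun p => ‖g‖ * p.2)
      (fun K => (g * truncSnd K).continuous.aestronglyMeasurable) (hFint.const_mul _)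
      (fun K => ?_) ?_
    · filter_upwards [hF] with p hp
      rw [BoundedContinuousFunction.mul_apply, norm_mul,
        Real.norm_of_nonneg (truncSnd_nonneg K p)]
      exact mul_le_mul (g.norm_coe_le_norm p) (truncSnd_le_snd K hp) (truncSnd_nonneg K p)
        (norm_nonneg _)
    · filter_upwards [hF] with p hp
      exact (tendsto_truncSnd hp).const_mul (g p)
  refine Metric.tendsto_nhds.2 fun ε hε => ?_
  have hδ : 0 < ε / (3 * (‖g‖ + 1)) := by positivity
  obtain ⟨K₀, hK₀⟩ := exists_eventually_measure_natCast_lt_toReal_rnDeriv_le P Q hcontig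
    (ENNReal.ofReal_pos.2 hδ)
  obtain ⟨K, hK, hKlim⟩ := ((eventually_ge_atTop K₀).and
    (Metric.tendsto_nhds.1 hlim (ε / 3) (by positivity))).exists
  filter_upwards [hK₀, Metric.tendsto_nhds.1 (hconv (g * truncSnd K)) (ε / 3) (by positivity)]
    with N hN hNconv
  have htail : (Q N).real {ω | (K : ℝ) < ((Q N).rnDeriv (P N) ω).toReal} ≤
      ε / (3 * (‖g‖ + 1)) := by
    refine ENNReal.toReal_le_of_le_ofReal hδ.le ((measure_mono fun ω hω => ?_).trans hN)
    exact lt_of_le_of_lt (Nat.cast_le.2 hK) (show (K : ℝ) < _ from hω)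
  have htrunc : ‖g‖ * (Q N).real {ω | (K : ℝ) < ((Q N).rnDeriv (P N) ω).toReal} ≤ ε / 3 :=
    calc _ ≤ (‖g‖ + 1) * (ε / (3 * (‖g‖ + 1))) := by gcongr; linarith
      _ = ε / 3 := by field_simp
  have happrox := (abs_integral_sub_integral_mul_truncSnd_le (P N) (Q N) (habs N) (hR N) g K).trans
    htrunc
  rw [← Real.dist_eq] at happrox
  linarith [dist_triangle4 (∫ ω, g (R N ω, ((Q N).rnDeriv (P N) ω).toReal) ∂(Q N))
    (∫ ω, (g * truncSnd K) (R N ω, ((Q N).rnDeriv (P N) ω).toReal) ∂(P N))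
    (∫ p, (g * truncSnd K) p ∂F) (∫ p, g p * p.2 ∂F)]
end
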